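/- Let (X₀, X₁)_X be a pair of compatible metric spaces with X₀ ∩ X₁ ≠ ∅, let θ ∈ (0, 1) and q ∈ [1, ∞], and let p ∈ [1, ∞] be the conjugate exponent of q (1/p + 1/q = 1). Then for all x, y ∈ X₀ ∩ X₁, K_M(1; x, y) ≤ M'_{θ,q} · δ_{θ,q}(x, y), where M'_{θ,q} := (Σ_{j∈ℤ} (2^{jθ}·min{1, 2^{-j}})^p)^{1/p} (with the obvious supremum modification if p = ∞). -/

import Mathlib

open scoped ENNReal Classical

/-- A function `d` is a metric on the subset `A` of `X`. -/
structure IsMetricOn {X : Type*} (d : X → X → ℝ) (A : Set X) : Prop where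
  refl : ∀ x ∈ A, d x x = 0
  eq_of_dist_eq_zero : ∀ x ∈ A, ∀ y ∈ A, d x y = 0 → x = y
  symm : ∀ x ∈ A, ∀ y ∈ A, d x y = d y x
  triangle : ∀ x ∈ A, ∀ y ∈ A, ∀ z ∈ A, d x z ≤ d x y + d y z

/-- A pair of compatible metric spaces `(X₀, X₁)_X` inside an ambient metric space `X`. -/
structure CompatiblePair (X : Type*) [MetricSpace X] where
  X0 : Set X
  X1 : Set X
  d0 : X → X → ℝ
  d1 : X → X → ℝ
  inter_nonempty : (X0 ∩ X1).Nonempty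
  met0 : IsMetricOn d0 X0
  met1 : IsMetricOn d1 X1
  C0 : ℝ
  C1 : ℝ
  C0_pos : 0 < C0
  C1_pos : 0 < C1
  compat0 : ∀ x ∈ X0, ∀ y ∈ X0, dist x y ≤ C0 * d0 x y
  compat1 : ∀ x ∈ X1, ∀ y ∈ X1, dist x y ≤ C1 * d1 x y

namespace CompatiblePair

variable {X : Type*} [MetricSpace X] (P : CompatiblePair X)

/-- The `J_M` functional: `J_M(t; x, y) = max {d₀(x,y), t·d₁(x,y)}`. -/
noncomputable def JM (t : ℝ) (x y : X) : ℝ := max (P.d0 x y) (t * P.d1 x y)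

/-- The cost function `h_t` on pairs in `X₀² ∪ X₁²`. -/
noncomputable def hFun (t : ℝ) (x y : X) : ℝ :=
  if x ∈ P.X0 ∩ P.X1 ∧ y ∈ P.X0 ∩ P.X1 then min (P.d0 x y) (t * P.d1 x y)
  else if x ∈ P.X0 ∧ y ∈ P.X0 then P.d0 x y
  else t * P.d1 x y

/-- `f 0 = x, …, f n = y` is an admissible linking sequence from `x` to `y` in `X₀ ∪ X₁`. -/
def IsAdmissibleChain (x y : X) (n : ℕ) (f : ℕ → X) : Prop :=
  f 0 = x ∧ f n = y ∧ (∀ k ≤ n, f k ∈ P.X0 ∪ P.X1) ∧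
    ∀ k < n, (f k ∈ P.X0 ∧ f (k + 1) ∈ P.X0) ∨ (f k ∈ P.X1 ∧ f (k + 1) ∈ P.X1)

/-- The `K_M` functional: infimum of `∑ h_t` over admissible linking sequences. -/
noncomputable def KM (t : ℝ) (x y : X) : ℝ :=
  sInf { s : ℝ | ∃ n f, P.IsAdmissibleChain x y n f ∧
    s = ∑ k ∈ Finset.range n, P.hFun t (f k) (f (k + 1)) }

end CompatiblePair

/-- The functional `Γ_{θ,q}` of a bi-infinite real sequence, valued in `[0,∞]`. -/
noncomputable def GammaE (θ : ℝ) (q : ℝ≥0∞) (x : ℤ → ℝ) : ℝ≥0∞ :=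
  if q = ∞ then ⨆ k : ℤ, ENNReal.ofReal ((2 : ℝ) ^ (-(k : ℝ) * θ) * |x k|)
  else (∑' k : ℤ, ENNReal.ofReal ((2 : ℝ) ^ (-(k : ℝ) * θ) * |x k|) ^ q.toReal) ^ (1 / q.toReal)

/-- The real-valued functional `Γ_{θ,q}`. -/
noncomputable def Gamma (θ : ℝ) (q : ℝ≥0∞) (x : ℤ → ℝ) : ℝ := (GammaE θ q x).toReal

/-- The constant `M_{θ,q} = Γ_{θ,q}((min{1, 2^k})_k)`. -/
noncomputable def MThetaQ (θ : ℝ) (q : ℝ≥0∞) : ℝ :=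
  Gamma θ q (fun k : ℤ => min 1 ((2 : ℝ) ^ k))

/-- The constant `M'_{θ,q} = (∑_j (2^{jθ} min{1,2^{-j}})^p)^{1/p}` (with `p` the
conjugate exponent of `q`, and the supremum modification for `p = ∞`). -/
noncomputable def MConst' (θ : ℝ) (p : ℝ≥0∞) : ℝ :=
  (if p = ∞ then ⨆ j : ℤ, ENNReal.ofReal ((2 : ℝ) ^ ((j : ℝ) * θ) * min 1 ((2 : ℝ) ^ (-(j : ℝ))))
   else (∑' j : ℤ,
      ENNReal.ofReal ((2 : ℝ) ^ ((j : ℝ) * θ) * min 1 ((2 : ℝ) ^ (-(j : ℝ)))) ^ p.toReal) ^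
        (1 / p.toReal)).toReal

/-- The `ℓ^q` norm of a bi-infinite real sequence, valued in `[0,∞]`. -/
noncomputable def lqNorm (q : ℝ≥0∞) (c : ℤ → ℝ) : ℝ≥0∞ :=
  if q = ∞ then ⨆ k : ℤ, ENNReal.ofReal |c k|
  else (∑' k : ℤ, ENNReal.ofReal |c k| ^ q.toReal) ^ (1 / q.toReal)

namespace CompatiblePair

variable {X : Type*} [MetricSpace X] (P : CompatiblePair X)

/-- The metric `β_{θ,q}(x,y) = Γ_{θ,q}((K_M(2^k; x, y))_k)` on `X₀ ∩ X₁`. -/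
noncomputable def beta (θ : ℝ) (q : ℝ≥0∞) (x y : X) : ℝ :=
  Gamma θ q (fun k : ℤ => P.KM ((2 : ℝ) ^ k) x y)

/-- `u` is an approximating sequence of `x` in `(X₀ ∩ X₁, J_M(1))`: a sequence in
`X₀ ∩ X₁`, Cauchy for `J_M(1)`, with `K_M(1; uₙ, x) → 0`. -/
def IsApproxSeq (x : X) (u : ℕ → X) : Prop :=
  (∀ n, u n ∈ P.X0 ∩ P.X1) ∧
  (∀ ε > 0, ∃ N, ∀ m ≥ N, ∀ n ≥ N, P.JM 1 (u m) (u n) < ε) ∧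
  Filter.Tendsto (fun n => P.KM 1 (u n) x) Filter.atTop (nhds 0)

/-- The bi-infinite linking sequence `S_k = u_k` for `k ≥ 0`, `S_k = v_{-k}` for `k < 0`. -/
noncomputable def linkSeq (u v : ℕ → X) : ℤ → X :=
  fun k => if 0 ≤ k then u k.toNat else v (-k).toNat

/-- The functional `p_{θ,q}` valued in `[0,∞]`: infimum of
`Γ_{θ,q}((J_M(2^k; S_k, S_{k+1}))_k)` over approximating sequences of `x` and `y`. -/
noncomputable def pFunE (θ : ℝ) (q : ℝ≥0∞) (x y : X) : ℝ≥0∞ :=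
  ⨅ (u : ℕ → X) (v : ℕ → X) (_ : P.IsApproxSeq x u) (_ : P.IsApproxSeq y v),
    GammaE θ q (fun k : ℤ =>
      P.JM ((2 : ℝ) ^ k) (linkSeq u v k) (linkSeq u v (k + 1)))

/-- The real-valued functional `p_{θ,q}`. -/
noncomputable def pFun (θ : ℝ) (q : ℝ≥0∞) (x y : X) : ℝ := (P.pFunE θ q x y).toReal

/-- The symmetrization `P_{θ,q}(x,y) = (p_{θ,q}(x,y) + p_{θ,q}(y,x))/2`. -/
noncomputable def PFun (θ : ℝ) (q : ℝ≥0∞) (x y : X) : ℝ :=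
  (P.pFun θ q x y + P.pFun θ q y x) / 2

/-- The metric `δ_{θ,q}`: infimum of `∑ P_{θ,q}` over finite chains in `X₀ ∩ X₁`. -/
noncomputable def delta (θ : ℝ) (q : ℝ≥0∞) (x y : X) : ℝ :=
  sInf { s : ℝ | ∃ (n : ℕ) (f : ℕ → X), f 0 = x ∧ f n = y ∧
    (∀ k ≤ n, f k ∈ P.X0 ∩ P.X1) ∧
    s = ∑ j ∈ Finset.range n, P.PFun θ q (f j) (f (j + 1)) }

end CompatiblePair

theorem IsMetricOn.nonneg {X : Type*} {d : X → X → ℝ} {A : Set X} (h : IsMetricOn d A)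
    {x y : X} (hx : x ∈ A) (hy : y ∈ A) : 0 ≤ d x y := by
  have := h.triangle x hx y hy x hx
  rw [h.refl x hx, h.symm y hy x hx] at this
  linarith

/-- The `ℓ^p` norm of a family of extended nonnegative reals indexed by `ℤ`. -/
noncomputable def ellpNorm (p : ℝ≥0∞) (a : ℤ → ℝ≥0∞) : ℝ≥0∞ :=
  if p = ∞ then ⨆ k : ℤ, a k else (∑' k : ℤ, a k ^ p.toReal) ^ (1 / p.toReal)

theorem le_ellpNorm_top (a : ℤ → ℝ≥0∞) (k : ℤ) : a k ≤ ellpNorm ∞ a := by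
  simpa [ellpNorm] using le_iSup a k

theorem sum_le_ellpNorm_one (a : ℤ → ℝ≥0∞) (s : Finset ℤ) : ∑ k ∈ s, a k ≤ ellpNorm 1 a := by
  simpa [ellpNorm] using ENNReal.sum_le_tsum (f := a) s

/-- Hölder's inequality for `ellpNorm`. -/
theorem sum_mul_le_ellpNorm_mul_ellpNorm {p q : ℝ≥0∞} [p.HolderConjugate q]
    (a b : ℤ → ℝ≥0∞) (s : Finset ℤ) :
    ∑ k ∈ s, a k * b k ≤ ellpNorm p a * ellpNorm q b := by
  by_cases hp : p = ∞
  · have hq : q = 1 := (ENNReal.HolderConjugate.eq_top_iff_eq_one p q).1 hp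
    subst hp hq
    calc ∑ k ∈ s, a k * b k ≤ ∑ k ∈ s, ellpNorm ∞ a * b k := by
          gcongr; exact le_ellpNorm_top a _
      _ = ellpNorm ∞ a * ∑ k ∈ s, b k := (Finset.mul_sum ..).symm
      _ ≤ _ := by gcongr; exact sum_le_ellpNorm_one b s
  by_cases hq : q = ∞
  · have hp : p = 1 := (ENNReal.HolderConjugate.eq_top_iff_eq_one q p).1 hq
    subst hp hq
    calc ∑ k ∈ s, a k * b k ≤ ∑ k ∈ s, a k * ellpNorm ∞ b := by
          gcongr; exact le_ellpNorm_top b _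
      _ = (∑ k ∈ s, a k) * ellpNorm ∞ b := (Finset.sum_mul ..).symm
      _ ≤ _ := by gcongr; exact sum_le_ellpNorm_one a s
  · have h := ENNReal.HolderConjugate.toReal_of_ne_top hp hq
    refine (ENNReal.inner_le_Lp_mul_Lq s a b h).trans ?_
    simp only [ellpNorm, if_neg hp, if_neg hq]
    have := h.nonneg
    have := h.symm.nonneg
    gcongr <;> exact ENNReal.sum_le_tsum s

theorem ellpNorm_ne_top_of_le_one {p : ℝ≥0∞} (hp : 1 ≤ p) {a : ℤ → ℝ≥0∞}
    (ha : ∀ k, a k ≤ 1) (hsum : ∑' k, a k ≠ ∞) : ellpNorm p a ≠ ∞ := by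
  unfold ellpNorm
  split_ifs with h
  · exact ne_top_of_le_ne_top ENNReal.one_ne_top (iSup_le ha)
  · have h1 : 1 ≤ p.toReal := by simpa using ENNReal.toReal_mono h hp
    refine ENNReal.rpow_ne_top_of_nonneg (by positivity)
      (ne_top_of_le_ne_top hsum (ENNReal.tsum_le_tsum fun k => ?_))
    simpa using ENNReal.rpow_le_rpow_of_exponent_ge (ha k) h1

theorem ellpNorm_ne_top_of_support {p : ℝ≥0∞} (hp : 1 ≤ p) {a : ℤ → ℝ≥0∞} (i : ℤ)
    (ha : ∀ k ≠ i, a k = 0) (hi : a i ≠ ∞) : ellpNorm p a ≠ ∞ := by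
  unfold ellpNorm
  split_ifs with h
  · refine ne_top_of_le_ne_top hi (iSup_le fun k => ?_)
    by_cases hk : k = i
    · rw [hk]
    · simp [ha k hk]
  · have h0 : 0 < p.toReal := ENNReal.toReal_pos (by positivity) h
    rw [tsum_eq_single i fun k hk => by rw [ha k hk, ENNReal.zero_rpow_of_pos h0]]
    exact ENNReal.rpow_ne_top_of_nonneg (by positivity)
      (ENNReal.rpow_ne_top_of_nonneg h0.le hi)

/-- The weights `2^{jθ} min{1, 2^{-j}}` whose `ℓ^p` norm is `M'_{θ,q}`. -/
noncomputable def mixWeight (θ : ℝ) (j : ℤ) : ℝ :=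
  (2 : ℝ) ^ ((j : ℝ) * θ) * min 1 ((2 : ℝ) ^ (-(j : ℝ)))

theorem mixWeight_nonneg (θ : ℝ) (j : ℤ) : 0 ≤ mixWeight θ j := by
  unfold mixWeight; positivity

theorem mixWeight_natCast_le (θ : ℝ) (n : ℕ) : mixWeight θ n ≤ ((2 : ℝ) ^ (θ - 1)) ^ n := by
  rw [← Real.rpow_mul_natCast (by norm_num)]
  calc mixWeight θ n ≤ (2 : ℝ) ^ ((n : ℝ) * θ) * (2 : ℝ) ^ (-(n : ℝ)) := by
        unfold mixWeight
        push_cast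
        gcongr
        exact min_le_right _ _
    _ = _ := by rw [← Real.rpow_add (by norm_num)]; ring_nf

theorem mixWeight_neg_natCast_le (θ : ℝ) (n : ℕ) :
    mixWeight θ (-(n : ℤ)) ≤ ((2 : ℝ) ^ (-θ)) ^ n := by
  rw [← Real.rpow_mul_natCast (by norm_num)]
  calc mixWeight θ (-(n : ℤ)) ≤ (2 : ℝ) ^ (-(n : ℝ) * θ) * 1 := by
        unfold mixWeight
        push_cast
        gcongr
        exact min_le_left _ _
    _ = _ := by ring_nf

theorem two_rpow_lt_one {s : ℝ} (hs : s < 0) : (2 : ℝ) ^ s < 1 :=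
  Real.rpow_lt_one_of_one_lt_of_neg (by norm_num) hs

theorem mixWeight_le_one {θ : ℝ} (hθ : θ ∈ Set.Ioo (0 : ℝ) 1) (j : ℤ) : mixWeight θ j ≤ 1 := by
  obtain ⟨n, rfl | rfl⟩ := j.eq_nat_or_neg
  · exact (mixWeight_natCast_le θ n).trans
      (pow_le_one₀ (by positivity) (two_rpow_lt_one (by linarith [hθ.2])).le)
  · exact (mixWeight_neg_natCast_le θ n).trans
      (pow_le_one₀ (by positivity) (two_rpow_lt_one (by linarith [hθ.1])).le)

theorem summable_mixWeight {θ : ℝ} (hθ : θ ∈ Set.Ioo (0 : ℝ) 1) : Summable (mixWeight θ) := by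
  refine Summable.of_nat_of_neg ?_ ?_
  · exact Summable.of_nonneg_of_le (fun n => mixWeight_nonneg θ _) (mixWeight_natCast_le θ)
      (summable_geometric_of_lt_one (by positivity) (two_rpow_lt_one (by linarith [hθ.2])))
  · exact Summable.of_nonneg_of_le (fun n => mixWeight_nonneg θ _) (mixWeight_neg_natCast_le θ)
      (summable_geometric_of_lt_one (by positivity) (two_rpow_lt_one (by linarith [hθ.1])))

theorem MConst'_eq_ellpNorm (θ : ℝ) (p : ℝ≥0∞) :
    MConst' θ p = (ellpNorm p fun j => ENNReal.ofReal (mixWeight θ j)).toReal := rfl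

theorem GammaE_eq_ellpNorm (θ : ℝ) (q : ℝ≥0∞) (x : ℤ → ℝ) :
    GammaE θ q x =
      ellpNorm q fun k => ENNReal.ofReal ((2 : ℝ) ^ (-(k : ℝ) * θ) * |x k|) := rfl

theorem ellpNorm_mixWeight_ne_top {θ : ℝ} (hθ : θ ∈ Set.Ioo (0 : ℝ) 1) {p : ℝ≥0∞} (hp : 1 ≤ p) :
    (ellpNorm p fun j => ENNReal.ofReal (mixWeight θ j)) ≠ ∞ :=
  ellpNorm_ne_top_of_le_one hp (fun j => by simpa using mixWeight_le_one hθ j)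
    (summable_mixWeight hθ).tsum_ofReal_ne_top

/-- Hölder's inequality splitting the weight `min{1, 2^{-k}}` between `MConst'` and `GammaE`. -/
theorem ofReal_sum_min_mul_le (θ : ℝ) {p q : ℝ≥0∞} [p.HolderConjugate q] {J : ℤ → ℝ}
    (hJ : ∀ k, 0 ≤ J k) (s : Finset ℤ) :
    ENNReal.ofReal (∑ k ∈ s, min 1 ((2 : ℝ) ^ (-(k : ℝ))) * J k) ≤
      (ellpNorm p fun j => ENNReal.ofReal (mixWeight θ j)) * GammaE θ q J := by
  rw [GammaE_eq_ellpNorm, ENNReal.ofReal_sum_of_nonneg fun k _ => mul_nonneg (by positivity) (hJ k)]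
  refine le_trans (le_of_eq (Finset.sum_congr rfl fun k _ => ?_))
    (sum_mul_le_ellpNorm_mul_ellpNorm _ _ s)
  rw [← ENNReal.ofReal_mul (mixWeight_nonneg θ k), abs_of_nonneg (hJ k), mixWeight, neg_mul,
    Real.rpow_neg (by norm_num) ((k : ℝ) * θ)]
  congr 1
  field_simp

namespace CompatiblePair

theorem linkSeq_natCast {X : Type*} (u v : ℕ → X) (n : ℕ) : linkSeq u v n = u n := by
  simp [linkSeq]

theorem linkSeq_neg_natCast {X : Type*} (u v : ℕ → X) {n : ℕ} (hn : 0 < n) :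
    linkSeq u v (-(n : ℤ)) = v n := by
  simp [linkSeq, show n ≠ 0 by omega]

variable {X : Type*} [MetricSpace X] (P : CompatiblePair X)

theorem JM_nonneg {t : ℝ} {x y : X} (hx : x ∈ P.X0 ∩ P.X1) (hy : y ∈ P.X0 ∩ P.X1) :
    0 ≤ P.JM t x y :=
  le_max_of_le_left (P.met0.nonneg hx.1 hy.1)

theorem JM_self {t : ℝ} {x : X} (hx : x ∈ P.X0 ∩ P.X1) : P.JM t x x = 0 := by
  simp [JM, P.met0.refl x hx.1, P.met1.refl x hx.2]

theorem hFun_nonneg {t : ℝ} (ht : 0 ≤ t) {x y : X}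
    (h : (x ∈ P.X0 ∧ y ∈ P.X0) ∨ (x ∈ P.X1 ∧ y ∈ P.X1)) : 0 ≤ P.hFun t x y := by
  unfold hFun
  split_ifs with h₁ h₂
  · exact le_min (P.met0.nonneg h₁.1.1 h₁.2.1)
      (mul_nonneg ht (P.met1.nonneg h₁.1.2 h₁.2.2))
  · exact P.met0.nonneg h₂.1 h₂.2
  · have h₃ := h.resolve_left h₂
    exact mul_nonneg ht (P.met1.nonneg h₃.1 h₃.2)

theorem hFun_comm {t : ℝ} {x y : X}
    (h : (x ∈ P.X0 ∧ y ∈ P.X0) ∨ (x ∈ P.X1 ∧ y ∈ P.X1)) : P.hFun t x y = P.hFun t y x := by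
  unfold hFun
  simp only [and_comm (a := y ∈ P.X0 ∩ P.X1), and_comm (a := y ∈ P.X0)]
  split_ifs with h₁ h₂
  · rw [P.met0.symm x h₁.1.1 y h₁.2.1, P.met1.symm x h₁.1.2 y h₁.2.2]
  · exact P.met0.symm x h₂.1 y h₂.2
  · have h₃ := h.resolve_left h₂
    rw [P.met1.symm x h₃.1 y h₃.2]

theorem KM_le {t : ℝ} (ht : 0 ≤ t) {x y : X} {n : ℕ} {f : ℕ → X}
    (h : P.IsAdmissibleChain x y n f) :
    P.KM t x y ≤ ∑ k ∈ Finset.range n, P.hFun t (f k) (f (k + 1)) := by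
  refine csInf_le ⟨0, ?_⟩ ⟨n, f, h, rfl⟩
  rintro _ ⟨m, g, hg, rfl⟩
  exact Finset.sum_nonneg fun k hk => P.hFun_nonneg ht (hg.2.2.2 k (Finset.mem_range.1 hk))

theorem KM_nonneg {t : ℝ} (ht : 0 ≤ t) (x y : X) : 0 ≤ P.KM t x y := by
  refine Real.sInf_nonneg ?_
  rintro _ ⟨m, g, hg, rfl⟩
  exact Finset.sum_nonneg fun k hk => P.hFun_nonneg ht (hg.2.2.2 k (Finset.mem_range.1 hk))

theorem KM_self {t : ℝ} (ht : 0 ≤ t) {x : X} (hx : x ∈ P.X0 ∩ P.X1) : P.KM t x x = 0 := by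
  refine le_antisymm ?_ (P.KM_nonneg ht x x)
  simpa using P.KM_le ht (n := 0) (f := fun _ => x)
    ⟨rfl, rfl, fun _ _ => Or.inl hx.1, fun _ h => absurd h (Nat.not_lt_zero _)⟩

theorem isAdmissibleChain_pair {x y : X} (hx : x ∈ P.X0 ∩ P.X1) (hy : y ∈ P.X0 ∩ P.X1) :
    P.IsAdmissibleChain x y 1 (fun k => if k = 0 then x else y) := by
  refine ⟨rfl, rfl, fun k _ => ?_, fun k hk => ?_⟩
  · dsimp only
    split_ifs
    exacts [Or.inl hx.1, Or.inl hy.1]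
  · obtain rfl : k = 0 := by omega
    exact Or.inl ⟨hx.1, hy.1⟩

theorem KM_le_min {t : ℝ} (ht : 0 ≤ t) {x y : X} (hx : x ∈ P.X0 ∩ P.X1)
    (hy : y ∈ P.X0 ∩ P.X1) : P.KM t x y ≤ min (P.d0 x y) (t * P.d1 x y) := by
  simpa [hFun, hx.1, hx.2, hy.1, hy.2] using P.KM_le ht (P.isAdmissibleChain_pair hx hy)

variable {P} in
theorem IsAdmissibleChain.reverse {x y : X} {n : ℕ} {f : ℕ → X}
    (h : P.IsAdmissibleChain x y n f) : P.IsAdmissibleChain y x n (fun k => f (n - k)) := by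
  refine ⟨by simpa using h.2.1, by simpa using h.1, fun k _ => h.2.2.1 _ (Nat.sub_le _ _),
    fun k hk => ?_⟩
  have := h.2.2.2 (n - (k + 1)) (by omega)
  rw [show n - (k + 1) + 1 = n - k by omega] at this
  tauto

variable {P} in
theorem IsAdmissibleChain.append {x y z : X} {n m : ℕ} {f g : ℕ → X}
    (hf : P.IsAdmissibleChain x y n f) (hg : P.IsAdmissibleChain y z m g) :
    P.IsAdmissibleChain x z (n + m) (fun k => if k < n then f k else g (k - n)) := by
  obtain ⟨hf0, hfn, hfmem, hfadj⟩ := hf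
  obtain ⟨hg0, hgm, hgmem, hgadj⟩ := hg
  refine ⟨?_, by simpa using hgm, fun k hk => ?_, fun k hk => ?_⟩
  · rcases Nat.eq_zero_or_pos n with rfl | hn
    · simpa [hg0] using hfn.symm.trans hf0
    · simpa [hn] using hf0
  · dsimp only
    split_ifs with h
    exacts [hfmem k h.le, hgmem _ (by omega)]
  · dsimp only
    rcases lt_trichotomy (k + 1) n with h | h | h
    · rw [if_pos h, if_pos (by omega)]
      exact hfadj k (by omega)
    · rw [if_pos (show k < n by omega), if_neg h.not_lt, show k + 1 - n = 0 by omega, hg0, ← hfn,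
        ← h]
      exact hfadj k (by omega)
    · rw [if_neg (by omega), if_neg (by omega), show k + 1 - n = k - n + 1 by omega]
      exact hgadj _ (by omega)

theorem KM_comm_le {t : ℝ} (ht : 0 ≤ t) {x y : X} (hx : x ∈ P.X0 ∩ P.X1)
    (hy : y ∈ P.X0 ∩ P.X1) : P.KM t x y ≤ P.KM t y x := by
  refine le_csInf ⟨_, 1, _, P.isAdmissibleChain_pair hy hx, rfl⟩ ?_
  rintro _ ⟨n, f, hf, rfl⟩
  refine (P.KM_le ht hf.reverse).trans (le_of_eq ?_)
  rw [← Finset.sum_range_reflect]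
  refine Finset.sum_congr rfl fun k hk => ?_
  have hk := Finset.mem_range.1 hk
  rw [show n - (n - 1 - k) = k + 1 by omega, show n - (n - 1 - k + 1) = k by omega]
  exact (P.hFun_comm (hf.2.2.2 k hk)).symm

theorem KM_comm {t : ℝ} (ht : 0 ≤ t) {x y : X} (hx : x ∈ P.X0 ∩ P.X1)
    (hy : y ∈ P.X0 ∩ P.X1) : P.KM t x y = P.KM t y x :=
  le_antisymm (P.KM_comm_le ht hx hy) (P.KM_comm_le ht hy hx)

theorem KM_triangle {t : ℝ} (ht : 0 ≤ t) {x y z : X} (hx : x ∈ P.X0 ∩ P.X1)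
    (hy : y ∈ P.X0 ∩ P.X1) (hz : z ∈ P.X0 ∩ P.X1) :
    P.KM t x z ≤ P.KM t x y + P.KM t y z := by
  rw [← sub_le_iff_le_add]
  refine le_csInf ⟨_, 1, _, P.isAdmissibleChain_pair hx hy, rfl⟩ ?_
  rintro _ ⟨n, f, hf, rfl⟩
  rw [sub_le_comm]
  refine le_csInf ⟨_, 1, _, P.isAdmissibleChain_pair hy hz, rfl⟩ ?_
  rintro _ ⟨m, g, hg, rfl⟩
  rw [sub_le_iff_le_add']
  refine (P.KM_le ht (hf.append hg)).trans (le_of_eq ?_)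
  rw [Finset.sum_range_add]
  congr 1
  · refine Finset.sum_congr rfl fun k hk => ?_
    have hk := Finset.mem_range.1 hk
    rw [if_pos hk]
    split_ifs with h
    · rfl
    · rw [show k + 1 - n = 0 by omega, hg.1, ← hf.2.1, show k + 1 = n by omega]
  · refine Finset.sum_congr rfl fun k _ => ?_
    rw [if_neg (by omega), if_neg (by omega), Nat.add_sub_cancel_left,
      show n + k + 1 - n = k + 1 by omega]

theorem KM_le_sum {t : ℝ} (ht : 0 ≤ t) (f : ℕ → X) (n : ℕ)
    (hf : ∀ k ≤ n, f k ∈ P.X0 ∩ P.X1) :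
    P.KM t (f 0) (f n) ≤ ∑ k ∈ Finset.range n, P.KM t (f k) (f (k + 1)) := by
  induction n with
  | zero => simp [P.KM_self ht (hf 0 le_rfl)]
  | succ n ih =>
    rw [Finset.sum_range_succ]
    have h := P.KM_triangle ht (hf 0 (by omega)) (hf n (by omega)) (hf (n + 1) le_rfl)
    linarith [ih fun k hk => hf k (by omega)]

theorem KM_one_le_min_mul_JM {x y : X} (hx : x ∈ P.X0 ∩ P.X1) (hy : y ∈ P.X0 ∩ P.X1) (k : ℤ) :
    P.KM 1 x y ≤ min 1 ((2 : ℝ) ^ (-(k : ℝ))) * P.JM ((2 : ℝ) ^ k) x y := by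
  have h := P.KM_le_min zero_le_one hx hy
  rw [min_mul_of_nonneg _ _ (P.JM_nonneg hx hy)]
  refine h.trans (min_le_min ?_ ?_)
  · rw [one_mul]
    exact le_max_left _ _
  · rw [Real.rpow_neg (by norm_num), Real.rpow_intCast, le_inv_mul_iff₀ (by positivity), one_mul]
    exact le_max_right _ _

theorem linkSeq_mem {u v : ℕ → X} (hu : ∀ n, u n ∈ P.X0 ∩ P.X1) (hv : ∀ n, v n ∈ P.X0 ∩ P.X1)
    (k : ℤ) : linkSeq u v k ∈ P.X0 ∩ P.X1 := by
  unfold linkSeq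
  split_ifs
  exacts [hu _, hv _]

/-- The `K_M`-distance between the two far ends of a bi-infinite sequence, estimated by
telescoping and Hölder's inequality. -/
theorem ofReal_KM_one_le_mul_GammaE (θ : ℝ) {p q : ℝ≥0∞} [p.HolderConjugate q] {S : ℤ → X}
    (hS : ∀ k, S k ∈ P.X0 ∩ P.X1) (n : ℕ) :
    ENNReal.ofReal (P.KM 1 (S (-(n : ℤ))) (S n)) ≤
      (ellpNorm p fun j => ENNReal.ofReal (mixWeight θ j)) *
        GammaE θ q (fun k : ℤ => P.JM ((2 : ℝ) ^ k) (S k) (S (k + 1))) := by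
  refine le_trans (ENNReal.ofReal_le_ofReal ?_) (ofReal_sum_min_mul_le θ
    (fun k => P.JM_nonneg (hS k) (hS (k + 1)))
    ((Finset.range (2 * n)).image fun i : ℕ => (i : ℤ) - n))
  rw [Finset.sum_image fun a _ b _ h => by simpa using h]
  have h := P.KM_le_sum zero_le_one (fun i : ℕ => S ((i : ℤ) - n)) (2 * n) fun k _ => hS _
  rw [show ((0 : ℕ) : ℤ) - n = -n by simp, show ((2 * n : ℕ) : ℤ) - n = n by push_cast; ring] at h
  refine h.trans (Finset.sum_le_sum fun i _ => ?_)
  rw [show ((i + 1 : ℕ) : ℤ) - n = (i : ℤ) - n + 1 by push_cast; ring]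
  exact P.KM_one_le_min_mul_JM (hS _) (hS _) _

theorem ofReal_KM_one_le_mul_GammaE_linkSeq {θ : ℝ} (hθ : θ ∈ Set.Ioo (0 : ℝ) 1)
    {p q : ℝ≥0∞} [p.HolderConjugate q] {x y : X} (hx : x ∈ P.X0 ∩ P.X1) (hy : y ∈ P.X0 ∩ P.X1)
    {u v : ℕ → X} (hu : P.IsApproxSeq x u) (hv : P.IsApproxSeq y v)
    (hΓ : GammaE θ q (fun k : ℤ =>
      P.JM ((2 : ℝ) ^ k) (linkSeq u v k) (linkSeq u v (k + 1))) ≠ ∞) :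
    ENNReal.ofReal (P.KM 1 x y) ≤
      (ellpNorm p fun j => ENNReal.ofReal (mixWeight θ j)) *
        GammaE θ q (fun k : ℤ =>
          P.JM ((2 : ℝ) ^ k) (linkSeq u v k) (linkSeq u v (k + 1))) := by
  set B := (ellpNorm p fun j => ENNReal.ofReal (mixWeight θ j)) *
    GammaE θ q (fun k : ℤ => P.JM ((2 : ℝ) ^ k) (linkSeq u v k) (linkSeq u v (k + 1))) with hB
  have hBtop : B ≠ ∞ :=
    ENNReal.mul_ne_top (ellpNorm_mixWeight_ne_top hθ (ENNReal.HolderConjugate.one_le p q)) hΓ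
  have hlim : Filter.Tendsto (fun n => P.KM 1 (u n) x + B.toReal + P.KM 1 (v n) y)
      Filter.atTop (nhds (0 + B.toReal + 0)) :=
    (hu.2.2.add_const _).add hv.2.2
  rw [zero_add, add_zero] at hlim
  refine ENNReal.ofReal_le_of_le_toReal (ge_of_tendsto hlim ?_)
  filter_upwards [Filter.eventually_gt_atTop 0] with n hn
  have h := P.ofReal_KM_one_le_mul_GammaE θ (p := p) (q := q) (P.linkSeq_mem hu.1 hv.1) n
  rw [← hB, linkSeq_natCast, linkSeq_neg_natCast u v hn, ENNReal.ofReal_le_iff_le_toReal hBtop] at h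
  have h₁ := P.KM_triangle zero_le_one hx (hu.1 n) hy
  have h₂ := P.KM_triangle zero_le_one (hu.1 n) (hv.1 n) hy
  rw [P.KM_comm zero_le_one hx (hu.1 n)] at h₁
  rw [P.KM_comm zero_le_one (hu.1 n) (hv.1 n)] at h₂
  linarith

theorem isApproxSeq_const {x : X} (hx : x ∈ P.X0 ∩ P.X1) : P.IsApproxSeq x fun _ => x :=
  ⟨fun _ => hx, fun ε hε => ⟨0, fun _ _ _ _ => by rwa [P.JM_self hx]⟩, by
    simp [P.KM_self zero_le_one hx]⟩

theorem pFunE_ne_top (θ : ℝ) {q : ℝ≥0∞} (hq : 1 ≤ q) {x y : X} (hx : x ∈ P.X0 ∩ P.X1)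
    (hy : y ∈ P.X0 ∩ P.X1) : P.pFunE θ q x y ≠ ∞ := by
  refine ne_top_of_le_ne_top ?_ (iInf₂_le_of_le (fun _ => x) (fun _ => y)
    (iInf₂_le (P.isApproxSeq_const hx) (P.isApproxSeq_const hy)))
  rw [GammaE_eq_ellpNorm]
  refine ellpNorm_ne_top_of_support hq (-1) (fun k hk => ?_) ENNReal.ofReal_ne_top
  rcases lt_or_gt_of_ne hk with h | h
  · simp [linkSeq, show ¬ 0 ≤ k by omega, show ¬ 0 ≤ k + 1 by omega, P.JM_self hy]
  · simp [linkSeq, show 0 ≤ k by omega, show 0 ≤ k + 1 by omega, P.JM_self hx]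

theorem KM_one_le_MConst'_mul_pFun {θ : ℝ} (hθ : θ ∈ Set.Ioo (0 : ℝ) 1) {q : ℝ≥0∞} (p : ℝ≥0∞)
    [p.HolderConjugate q] {x y : X} (hx : x ∈ P.X0 ∩ P.X1) (hy : y ∈ P.X0 ∩ P.X1) :
    P.KM 1 x y ≤ MConst' θ p * P.pFun θ q x y := by
  have hM := ellpNorm_mixWeight_ne_top hθ (ENNReal.HolderConjugate.one_le p q)
  have hp := P.pFunE_ne_top θ (ENNReal.HolderConjugate.one_le q p) hx hy
  rw [MConst'_eq_ellpNorm, pFun, ← ENNReal.toReal_mul,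
    ← ENNReal.ofReal_le_iff_le_toReal (ENNReal.mul_ne_top hM hp), mul_comm,
    ← ENNReal.div_le_iff_le_mul (Or.inr hp) (Or.inl hM)]
  refine le_iInf₂ fun u v => le_iInf₂ fun hu hv => ?_
  by_cases hΓ : GammaE θ q (fun k : ℤ =>
      P.JM ((2 : ℝ) ^ k) (linkSeq u v k) (linkSeq u v (k + 1))) = ∞
  · rw [hΓ]
    exact le_top
  · exact ENNReal.div_le_of_le_mul' (P.ofReal_KM_one_le_mul_GammaE_linkSeq hθ hx hy hu hv hΓ)

theorem KM_one_le_MConst'_mul_PFun {θ : ℝ} (hθ : θ ∈ Set.Ioo (0 : ℝ) 1) {q : ℝ≥0∞} (p : ℝ≥0∞)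
    [p.HolderConjugate q] {x y : X} (hx : x ∈ P.X0 ∩ P.X1) (hy : y ∈ P.X0 ∩ P.X1) :
    P.KM 1 x y ≤ MConst' θ p * P.PFun θ q x y := by
  have h₁ := P.KM_one_le_MConst'_mul_pFun hθ p (q := q) hx hy
  have h₂ := P.KM_one_le_MConst'_mul_pFun hθ p (q := q) hy hx
  rw [P.KM_comm zero_le_one hy hx] at h₂
  unfold PFun
  linarith

end CompatiblePair

/-- `K_M(1; x, y) ≤ M'_{θ,q} · δ_{θ,q}(x, y)` on `X₀ ∩ X₁`, where
`p` is the conjugate exponent of `q`. -/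
theorem KM_one_le_MConst'_mul_delta {X : Type*} [MetricSpace X] (P : CompatiblePair X)
    (θ : ℝ) (hθ : θ ∈ Set.Ioo (0 : ℝ) 1) (q p : ℝ≥0∞) (hq : 1 ≤ q)
    (hpq : 1 / p + 1 / q = 1) :
    ∀ x ∈ P.X0 ∩ P.X1, ∀ y ∈ P.X0 ∩ P.X1,
      P.KM 1 x y ≤ MConst' θ p * P.delta θ q x y := by
  intro x hx y hy
  have : p.HolderConjugate q := ⟨by simpa using hpq⟩
  rw [CompatiblePair.delta, ← smul_eq_mul,
    ← Real.sInf_smul_of_nonneg (show 0 ≤ MConst' θ p from ENNReal.toReal_nonneg)]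
  refine le_csInf (Set.Nonempty.smul_set ⟨_, 1, fun k => if k = 0 then x else y, rfl, rfl,
    fun k _ => ?_, rfl⟩) ?_
  · dsimp only
    split_ifs
    exacts [hx, hy]
  · rintro _ ⟨_, ⟨n, f, rfl, rfl, hf, rfl⟩, rfl⟩
    dsimp only
    rw [smul_eq_mul, Finset.mul_sum]
    refine (P.KM_le_sum zero_le_one f n hf).trans (Finset.sum_le_sum fun k hk => ?_)
    have hk := Finset.mem_range.1 hk
    exact P.KM_one_le_MConst'_mul_PFun hθ p (hf k hk.le) (hf (k + 1) hk)
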